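/- Let R be a ring, M an R-module of finite length, and X a simple R-module. Then there exists a submodule N ≤ M with the following property: for every submodule M' ≤ M, the quotient module M/M' has no composition factor isomorphic to X if and only if N ≤ M'. -/

import Mathlib

/-- A surjection onto `X` from a submodule of `M` which kills every element of `A`: this exhibits
`X` as a subquotient of `M ⧸ A`. -/
def HasSubquotientModulo {R M : Type*} [Ring R] [AddCommGroup M] [Module R M]
    (X : Type*) [AddCommGroup X] [Module R X] (A : Submodule R M) : Prop :=
  ∃ (p : Submodule R M) (f : p →ₗ[R] X), Function.Surjective f ∧ ∀ x : p, (x : M) ∈ A → f x = 0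

namespace HasSubquotientModulo

variable {R M X : Type*} [Ring R] [AddCommGroup M] [Module R M] [AddCommGroup X] [Module R X]

theorem anti {A B : Submodule R M} (hAB : A ≤ B) (h : HasSubquotientModulo X B) :
    HasSubquotientModulo X A := by
  obtain ⟨p, f, hf, hB⟩ := h
  exact ⟨p, f, hf, fun x hx => hB x (hAB hx)⟩

theorem not_top [Nontrivial X] : ¬ HasSubquotientModulo X (⊤ : Submodule R M) := by
  rintro ⟨p, f, hf, h⟩
  obtain ⟨y, hy⟩ := exists_ne (0 : X)
  obtain ⟨x, rfl⟩ := hf y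
  exact hy (h x trivial)

theorem of_inf [IsSimpleModule R X] {A B : Submodule R M} (h : HasSubquotientModulo X (A ⊓ B)) :
    HasSubquotientModulo X A ∨ HasSubquotientModulo X B := by
  obtain ⟨p, f, hf, hAB⟩ := h
  let g : ↥(p ⊓ A) →ₗ[R] X := f ∘ₗ Submodule.inclusion inf_le_left
  rcases g.surjective_or_eq_zero with hg | hg
  · exact Or.inr ⟨p ⊓ A, g, hg, fun x hx => hAB _ ⟨x.2.2, hx⟩⟩
  · exact Or.inl ⟨p, f, hf, fun x hx => LinearMap.congr_fun hg ⟨x, x.2, hx⟩⟩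

theorem iff_exists_subquotient {A : Submodule R M} :
    HasSubquotientModulo X A ↔ ∃ (p q : Submodule R (M ⧸ A)), q ≤ p ∧
      Nonempty ((↥p ⧸ q.comap p.subtype) ≃ₗ[R] X) := by
  constructor
  · rintro ⟨p, f, hf, hA⟩
    refine ⟨p.map A.mkQ, ((LinearMap.ker f).map p.subtype).map A.mkQ,
      Submodule.map_mono (Submodule.map_subtype_le p _), ?_⟩
    let q := (((LinearMap.ker f).map p.subtype).map A.mkQ).comap (p.map A.mkQ).subtype
    let g : ↥p →ₗ[R] ↥(p.map A.mkQ) ⧸ q := q.mkQ ∘ₗ A.mkQ.submoduleMap p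
    have hg : Function.Surjective g :=
      q.mkQ_surjective.comp (A.mkQ.submoduleMap_surjective p)
    have hker : LinearMap.ker g = LinearMap.ker f := by
      ext x
      have hx : x ∈ LinearMap.ker g ↔
          A.mkQ (x : M) ∈ ((LinearMap.ker f).map p.subtype).map A.mkQ :=
        Submodule.Quotient.mk_eq_zero q
      rw [hx]
      constructor
      · rintro ⟨_, ⟨y, hy, rfl⟩, hxy⟩
        have h := hA (y - x) ((Submodule.Quotient.eq A).1 hxy)
        rw [map_sub, LinearMap.mem_ker.1 hy, zero_sub, neg_eq_zero] at h
        exact h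
      · intro h
        exact ⟨x, ⟨x, h, rfl⟩, rfl⟩
    exact ⟨(g.quotKerEquivOfSurjective hg).symm ≪≫ₗ Submodule.quotEquivOfEq _ _ hker ≪≫ₗ
      f.quotKerEquivOfSurjective hf⟩
  · rintro ⟨p, q, -, ⟨e⟩⟩
    let g : ↥(p.comap A.mkQ) →ₗ[R] ↥p := A.mkQ.restrict fun _ hx => hx
    refine ⟨p.comap A.mkQ, e.toLinearMap ∘ₗ (q.comap p.subtype).mkQ ∘ₗ g, ?_, fun x hx => ?_⟩
    · refine e.surjective.comp ((Submodule.mkQ_surjective _).comp ?_)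
      rintro ⟨y, hy⟩
      obtain ⟨x, rfl⟩ := A.mkQ_surjective y
      exact ⟨⟨x, hy⟩, rfl⟩
    · have hgx : g x = 0 := Subtype.ext ((Submodule.Quotient.mk_eq_zero A).2 hx)
      simp [hgx]

end HasSubquotientModulo


/-- Let `R` be a ring, `M` an `R`-module of finite length and `X` a simple
`R`-module. Then there is a submodule `N ≤ M` such that for every submodule `M' ≤ M`, the
quotient `M/M'` has no composition factor isomorphic to `X` (i.e. no subquotient of `M/M'`
is isomorphic to `X`) if and only if `N ≤ M'`. -/
theorem statement_18 {R : Type*} [Ring R] {M : Type*} [AddCommGroup M] [Module R M]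
    (hM : IsFiniteLength R M) {X : Type*} [AddCommGroup X] [Module R X]
    (hX : IsSimpleModule R X) :
    ∃ N : Submodule R M, ∀ M' : Submodule R M,
      (¬ ∃ (p q : Submodule R (M ⧸ M')), q ≤ p ∧
          Nonempty ((↥p ⧸ q.comap p.subtype) ≃ₗ[R] X)) ↔ N ≤ M' := by
  have := (isFiniteLength_iff_isNoetherian_isArtinian.1 hM).2
  have := IsSimpleModule.nontrivial R X
  obtain ⟨N, hN, hmin⟩ := WellFounded.has_min (wellFounded_lt (α := Submodule R M))
    {A | ¬ HasSubquotientModulo X A} ⟨⊤, HasSubquotientModulo.not_top⟩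
  refine ⟨N, fun M' => ?_⟩
  rw [← HasSubquotientModulo.iff_exists_subquotient]
  refine ⟨fun hM' => ?_, fun h hM' => hN (hM'.anti h)⟩
  have hinf : ¬ HasSubquotientModulo X (N ⊓ M') := fun h => h.of_inf.elim hN hM'
  exact inf_eq_left.1 (inf_le_left.eq_of_not_lt (hmin _ hinf))
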